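/- Let μ_{2,3} be the permutation of {1,…,5} whose one-line notation is 5, 4, 1, 2, 3. Then for all n ≥ 1, |S_n(132, 3241, μ_{2,3})| = F_{n+8} − C(n+1, 4) − 3·C(n+1, 3) − 4·C(n+1, 2) − 9·C(n+1, 1) − 11, where F_m denotes the m-th Fibonacci number and C(a,b) denotes the binomial coefficient. -/

import Mathlib

/-- `π` contains `σ` as a pattern: there is a subsequence of `π` (in one-line notation)
whose entries are in the same relative order as those of `σ`. -/
def PContains {n k : ℕ} (π : Equiv.Perm (Fin n)) (σ : Equiv.Perm (Fin k)) : Prop :=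
  ∃ f : Fin k → Fin n, StrictMono f ∧ ∀ s t : Fin k, π (f s) < π (f t) ↔ σ s < σ t

/-- `π` avoids the pattern `σ`. -/
def PAvoids {n k : ℕ} (π : Equiv.Perm (Fin n)) (σ : Equiv.Perm (Fin k)) : Prop :=
  ¬ PContains π σ

/-- The pattern 132 (one-line notation `1,3,2`, zero-indexed `0,2,1`). -/
noncomputable def p132 : Equiv.Perm (Fin 3) := Equiv.ofBijective ![0, 2, 1] (by decide)

/-- The pattern 3241 (zero-indexed `2,1,3,0`). -/
noncomputable def p3241 : Equiv.Perm (Fin 4) := Equiv.ofBijective ![2, 1, 3, 0] (by decide)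

/-- The pattern `μ_{2,3}` with one-line notation `5,4,1,2,3` (zero-indexed `4,3,0,1,2`). -/
noncomputable def mu23 : Equiv.Perm (Fin 5) :=
  Equiv.ofBijective ![4, 3, 0, 1, 2] (by decide)

/-- `f` permutes `{0, …, n - 1}` and fixes every other natural number. -/
structure IsPermBelow (n : ℕ) (f : ℕ → ℕ) : Prop where
  lt : ∀ i < n, f i < n
  inj : ∀ i < n, ∀ j < n, f i = f j → i = j
  fix : ∀ i, n ≤ i → f i = i

/-- The restriction of `f` to `{0, …, n - 1}` avoids `12`. -/
def Avoids12 (n : ℕ) (f : ℕ → ℕ) : Prop :=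
  ∀ i j, i < j → j < n → ¬ f i < f j

/-- The restriction of `f` to `{0, …, n - 1}` avoids `123`. -/
def Avoids123 (n : ℕ) (f : ℕ → ℕ) : Prop :=
  ∀ i j k, i < j → j < k → k < n → ¬ (f i < f j ∧ f j < f k)

/-- The restriction of `f` to `{0, …, n - 1}` avoids `132`. -/
def Avoids132 (n : ℕ) (f : ℕ → ℕ) : Prop :=
  ∀ i j k, i < j → j < k → k < n → ¬ (f i < f k ∧ f k < f j)

/-- The restriction of `f` to `{0, …, n - 1}` avoids `3241`. -/
def Avoids3241 (n : ℕ) (f : ℕ → ℕ) : Prop :=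
  ∀ i j k l, i < j → j < k → k < l → l < n → ¬ (f l < f j ∧ f j < f i ∧ f i < f k)

/-- The restriction of `f` to `{0, …, n - 1}` avoids `4123`. -/
def Avoids4123 (n : ℕ) (f : ℕ → ℕ) : Prop :=
  ∀ i j k l, i < j → j < k → k < l → l < n → ¬ (f j < f k ∧ f k < f l ∧ f l < f i)

/-- The restriction of `f` to `{0, …, n - 1}` avoids `54123`. -/
def Avoids54123 (n : ℕ) (f : ℕ → ℕ) : Prop :=
  ∀ h i j k l, h < i → i < j → j < k → k < l → l < n →
    ¬ (f j < f k ∧ f k < f l ∧ f l < f i ∧ f i < f h)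

/-- The skew sum of the identity of size `m` and the permutation `f` of size `r`. -/
def skewIdSum (m r : ℕ) (f : ℕ → ℕ) (i : ℕ) : ℕ :=
  if i < m then i + r else if i < m + r then f (i - m) else i

section SkewIdSum

variable {m r : ℕ} {f : ℕ → ℕ}

lemma skewIdSum_of_lt {i : ℕ} (hi : i < m) : skewIdSum m r f i = i + r := by
  simp [skewIdSum, hi]

lemma skewIdSum_add {j : ℕ} (hj : j < r) : skewIdSum m r f (m + j) = f j := by
  simp [skewIdSum, hj]

lemma skewIdSum_of_le {i : ℕ} (hi : m + r ≤ i) : skewIdSum m r f i = i := by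
  simp [skewIdSum, show ¬ i < m by omega, show ¬ i < m + r by omega]

lemma skewIdSum_cases (hf : IsPermBelow r f) {i : ℕ} (hi : i < m + r) :
    (i < m ∧ skewIdSum m r f i = i + r) ∨
      ∃ j < r, i = m + j ∧ skewIdSum m r f i = f j ∧ f j < r := by
  by_cases h : i < m
  · exact .inl ⟨h, skewIdSum_of_lt h⟩
  · obtain ⟨j, rfl⟩ := Nat.exists_eq_add_of_le (not_lt.1 h)
    have hj : j < r := by omega
    exact .inr ⟨j, hj, rfl, skewIdSum_add hj, hf.lt j hj⟩

lemma isPermBelow_skewIdSum (hf : IsPermBelow r f) : IsPermBelow (m + r) (skewIdSum m r f) where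
  lt i hi := by
    rcases skewIdSum_cases hf hi with h | ⟨j, h⟩ <;> omega
  inj i hi j hj h := by
    rcases skewIdSum_cases hf hi with h1 | ⟨a, h1⟩ <;>
    rcases skewIdSum_cases hf hj with h2 | ⟨b, h2⟩
    · omega
    · omega
    · omega
    · have := hf.inj a h1.1 b h2.1 (by omega)
      omega
  fix i hi := skewIdSum_of_le hi

lemma skewIdSum_injOn : Set.InjOn (skewIdSum m r) {f | IsPermBelow r f} := by
  intro f hf g hg h
  ext i
  by_cases hi : i < r
  · rw [← skewIdSum_add (m := m) (f := f) hi, h, skewIdSum_add hi]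
  · rw [hf.fix i (by omega), hg.fix i (by omega)]

lemma avoids12_skewIdSum (hm : 0 < m) (hf : IsPermBelow r f) :
    Avoids12 (m + r) (skewIdSum m r f) ↔ m = 1 ∧ Avoids12 r f := by
  constructor
  · intro h
    constructor
    · by_contra hne
      have := h 0 1 (by omega) (by omega)
      rw [skewIdSum_of_lt (by omega), skewIdSum_of_lt (by omega)] at this
      omega
    · intro i j hij hj
      have := h (m + i) (m + j) (by omega) (by omega)
      rwa [skewIdSum_add (by omega), skewIdSum_add (by omega)] at this
  · rintro ⟨rfl, h⟩ i j hij hj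
    rcases skewIdSum_cases hf hj with h2 | ⟨b, h2⟩
    · omega
    rcases skewIdSum_cases hf (hij.trans hj) with h1 | ⟨a, h1⟩
    · omega
    have := h a b (by omega) (by omega)
    omega

lemma avoids123_skewIdSum (hf : IsPermBelow r f) :
    Avoids123 (m + r) (skewIdSum m r f) ↔ m ≤ 2 ∧ Avoids123 r f := by
  constructor
  · intro h
    constructor
    · by_contra hne
      have := h 0 1 2 (by omega) (by omega) (by omega)
      rw [skewIdSum_of_lt (by omega), skewIdSum_of_lt (by omega),
        skewIdSum_of_lt (by omega)] at this
      omega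
    · intro i j k hij hjk hk
      have := h (m + i) (m + j) (m + k) (by omega) (by omega) (by omega)
      rwa [skewIdSum_add (by omega), skewIdSum_add (by omega), skewIdSum_add (by omega)] at this
  · rintro ⟨hm, h⟩ i j k hij hjk hk
    rcases skewIdSum_cases hf hk with h3 | ⟨c, h3⟩
    · omega
    rcases skewIdSum_cases hf (hjk.trans hk) with h2 | ⟨b, h2⟩
    · omega
    rcases skewIdSum_cases hf (hij.trans (hjk.trans hk)) with h1 | ⟨a, h1⟩
    · omega
    have := h a b c (by omega) (by omega) (by omega)
    omega

lemma avoids132_skewIdSum (hf : IsPermBelow r f) :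
    Avoids132 (m + r) (skewIdSum m r f) ↔ Avoids132 r f := by
  constructor
  · intro h i j k hij hjk hk
    have := h (m + i) (m + j) (m + k) (by omega) (by omega) (by omega)
    rwa [skewIdSum_add (by omega), skewIdSum_add (by omega), skewIdSum_add (by omega)] at this
  · rintro h i j k hij hjk hk
    rcases skewIdSum_cases hf (hij.trans (hjk.trans hk)) with h1 | ⟨a, h1⟩ <;>
    rcases skewIdSum_cases hf (hjk.trans hk) with h2 | ⟨b, h2⟩ <;>
    rcases skewIdSum_cases hf hk with h3 | ⟨c, h3⟩ <;> try omega
    have := h a b c (by omega) (by omega) (by omega)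
    omega

lemma avoids3241_skewIdSum (hf : IsPermBelow r f) :
    Avoids3241 (m + r) (skewIdSum m r f) ↔ Avoids3241 r f := by
  constructor
  · intro h i j k l hij hjk hkl hl
    have := h (m + i) (m + j) (m + k) (m + l) (by omega) (by omega) (by omega) (by omega)
    rwa [skewIdSum_add (by omega), skewIdSum_add (by omega), skewIdSum_add (by omega),
      skewIdSum_add (by omega)] at this
  · rintro h i j k l hij hjk hkl hl
    rcases skewIdSum_cases hf (hij.trans (hjk.trans (hkl.trans hl))) with h1 | ⟨a, h1⟩ <;>
    rcases skewIdSum_cases hf (hjk.trans (hkl.trans hl)) with h2 | ⟨b, h2⟩ <;>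
    rcases skewIdSum_cases hf (hkl.trans hl) with h3 | ⟨c, h3⟩ <;>
    rcases skewIdSum_cases hf hl with h4 | ⟨d, h4⟩ <;> try omega
    have := h a b c d (by omega) (by omega) (by omega) (by omega)
    omega

lemma avoids4123_skewIdSum (hm : 0 < m) (hf : IsPermBelow r f) :
    Avoids4123 (m + r) (skewIdSum m r f) ↔ Avoids123 r f := by
  constructor
  · intro h i j k hij hjk hk
    have := h 0 (m + i) (m + j) (m + k) (by omega) (by omega) (by omega) (by omega)
    rw [skewIdSum_of_lt hm, skewIdSum_add (by omega), skewIdSum_add (by omega),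
      skewIdSum_add (by omega)] at this
    have := hf.lt k hk
    omega
  · rintro h i j k l hij hjk hkl hl
    rcases skewIdSum_cases hf (hij.trans (hjk.trans (hkl.trans hl))) with h1 | ⟨a, h1⟩ <;>
    rcases skewIdSum_cases hf (hjk.trans (hkl.trans hl)) with h2 | ⟨b, h2⟩ <;>
    rcases skewIdSum_cases hf (hkl.trans hl) with h3 | ⟨c, h3⟩ <;>
    rcases skewIdSum_cases hf hl with h4 | ⟨d, h4⟩ <;> try omega
    all_goals
      have := h b c d (by omega) (by omega) (by omega)
      omega

lemma avoids54123_skewIdSum (hm : 0 < m) (hf : IsPermBelow r f) :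
    Avoids54123 (m + r) (skewIdSum m r f) ↔ Avoids4123 r f := by
  constructor
  · intro h i j k l hij hjk hkl hl
    have := h 0 (m + i) (m + j) (m + k) (m + l) (by omega) (by omega) (by omega) (by omega)
      (by omega)
    rw [skewIdSum_of_lt hm, skewIdSum_add (by omega), skewIdSum_add (by omega),
      skewIdSum_add (by omega), skewIdSum_add (by omega)] at this
    have := hf.lt i (by omega)
    omega
  · rintro h e i j k l hei hij hjk hkl hl
    rcases skewIdSum_cases hf (hei.trans (hij.trans (hjk.trans (hkl.trans hl)))) with
      h0 | ⟨z, h0⟩ <;>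
    rcases skewIdSum_cases hf (hij.trans (hjk.trans (hkl.trans hl))) with h1 | ⟨a, h1⟩ <;>
    rcases skewIdSum_cases hf (hjk.trans (hkl.trans hl)) with h2 | ⟨b, h2⟩ <;>
    rcases skewIdSum_cases hf (hkl.trans hl) with h3 | ⟨c, h3⟩ <;>
    rcases skewIdSum_cases hf hl with h4 | ⟨d, h4⟩ <;> try omega
    all_goals
      have := h a b c d (by omega) (by omega) (by omega) (by omega)
      omega

end SkewIdSum

section Succ

variable {n : ℕ} {f : ℕ → ℕ}

lemma IsPermBelow.succ (hf : IsPermBelow n f) : IsPermBelow (n + 1) f where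
  lt i hi := by
    rcases Nat.lt_succ_iff_lt_or_eq.1 hi with h | rfl
    · exact (hf.lt i h).trans (by omega)
    · rw [hf.fix i le_rfl]; omega
  inj i hi j hj h := by
    have := hf.lt i
    have := hf.lt j
    have := hf.fix i
    have := hf.fix j
    have := hf.inj i
    by_cases h1 : i < n <;> by_cases h2 : j < n
    · exact hf.inj i h1 j h2 h
    all_goals omega
  fix i hi := hf.fix i (by omega)

lemma IsPermBelow.of_succ (hf : IsPermBelow (n + 1) f) (hn : f n = n) : IsPermBelow n f where
  lt i hi := by
    have := hf.lt i (by omega)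
    have := hf.inj i (by omega) n (by omega)
    omega
  inj i hi j hj h := hf.inj i (by omega) j (by omega) h
  fix i hi := by
    rcases hi.eq_or_lt with rfl | h
    · exact hn
    · exact hf.fix i h

lemma avoids12_succ (hf : IsPermBelow n f) : Avoids12 (n + 1) f ↔ n = 0 := by
  constructor
  · intro h
    by_contra hn
    have := h 0 n (by omega) (by omega)
    have := hf.lt 0 (by omega)
    have := hf.fix n le_rfl
    omega
  · rintro rfl i j hij hj
    omega

lemma avoids123_succ (hf : IsPermBelow n f) : Avoids123 (n + 1) f ↔ Avoids12 n f := by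
  constructor
  · intro h i j hij hj
    have := h i j n hij hj (by omega)
    have := hf.lt j hj
    have := hf.fix n le_rfl
    omega
  · intro h i j k hij hjk hk
    have := h i j hij (by omega)
    omega

lemma avoids132_succ (hf : IsPermBelow n f) : Avoids132 (n + 1) f ↔ Avoids132 n f := by
  refine ⟨fun h i j k hij hjk hk => h i j k hij hjk (by omega), fun h i j k hij hjk hk => ?_⟩
  rcases Nat.lt_succ_iff_lt_or_eq.1 hk with h' | rfl
  · exact h i j k hij hjk h'
  · have := hf.lt j hjk
    have := hf.fix k le_rfl
    omega

lemma avoids3241_succ (hf : IsPermBelow n f) : Avoids3241 (n + 1) f ↔ Avoids3241 n f := by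
  refine ⟨fun h i j k l hij hjk hkl hl => h i j k l hij hjk hkl (by omega),
    fun h i j k l hij hjk hkl hl => ?_⟩
  rcases Nat.lt_succ_iff_lt_or_eq.1 hl with h' | rfl
  · exact h i j k l hij hjk hkl h'
  · have := hf.lt j (by omega)
    have := hf.fix l le_rfl
    omega

lemma avoids4123_succ (hf : IsPermBelow n f) : Avoids4123 (n + 1) f ↔ Avoids4123 n f := by
  refine ⟨fun h i j k l hij hjk hkl hl => h i j k l hij hjk hkl (by omega),
    fun h i j k l hij hjk hkl hl => ?_⟩
  rcases Nat.lt_succ_iff_lt_or_eq.1 hl with h' | rfl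
  · exact h i j k l hij hjk hkl h'
  · have := hf.lt i (by omega)
    have := hf.fix l le_rfl
    omega

lemma avoids54123_succ (hf : IsPermBelow n f) : Avoids54123 (n + 1) f ↔ Avoids54123 n f := by
  refine ⟨fun h e i j k l hei hij hjk hkl hl => h e i j k l hei hij hjk hkl (by omega),
    fun h e i j k l hei hij hjk hkl hl => ?_⟩
  rcases Nat.lt_succ_iff_lt_or_eq.1 hl with h' | rfl
  · exact h e i j k l hei hij hjk hkl h'
  · have := hf.lt i (by omega)
    have := hf.fix l le_rfl
    omega

end Succ

lemma IsPermBelow.exists_eq {n : ℕ} {f : ℕ → ℕ} (hf : IsPermBelow n f) {v : ℕ} (hv : v < n) :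
    ∃ k < n, f k = v := by
  have := Finset.surjOn_of_injOn_of_card_le (s := Finset.range n) (t := Finset.range n) f
    (fun i hi => by simpa using hf.lt i (by simpa using hi))
    (fun i hi j hj h => hf.inj i (by simpa using hi) j (by simpa using hj) h) le_rfl
  obtain ⟨k, hk, h⟩ := this (show v ∈ (Finset.range n : Set ℕ) by simpa using hv)
  exact ⟨k, by simpa using hk, h⟩

/-- A permutation avoiding `132` and `3241` either has its maximum at the end or is a skew sum
of a nonempty identity and a nonempty permutation. -/
lemma IsPermBelow.exists_eq_skewIdSum {n : ℕ} {f : ℕ → ℕ} (hf : IsPermBelow (n + 1) f)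
    (h132 : Avoids132 (n + 1) f) (h3241 : Avoids3241 (n + 1) f) (hn : f n ≠ n) :
    ∃ r < n, ∃ g, IsPermBelow (r + 1) g ∧ f = skewIdSum (n - r) (r + 1) g := by
  obtain ⟨k, hk, hkn⟩ := hf.exists_eq (v := n) (by omega)
  have hkn' : k < n := by
    rcases Nat.lt_succ_iff_lt_or_eq.1 hk with h | rfl
    · exact h
    · exact absurd hkn hn
  have lt_of_ne : ∀ i, i < n + 1 → i ≠ k → f i < n := fun i hi hik => by
    have := hf.lt i hi
    have := hf.inj i hi k hk
    omega
  have after_lt : ∀ i j, i ≤ k → k < j → j < n + 1 → f j < f i := fun i j hi hj hjn => by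
    have := lt_of_ne j hjn (by omega)
    rcases hi.eq_or_lt with rfl | hi
    · omega
    · have := h132 i k j hi hj hjn
      have := hf.inj i (by omega) j hjn
      omega
  have mono : ∀ i j, i < j → j ≤ k → f i < f j := fun i j hij hj => by
    have := lt_of_ne i (by omega) (by omega)
    rcases hj.eq_or_lt with rfl | hj
    · omega
    · have := h3241 i j k n hij hj hkn' (by omega)
      have := after_lt j n hj.le hkn' (by omega)
      have := hf.inj i (by omega) j (by omega)
      omega
  have lower : ∀ i ≤ k, n - k + i ≤ f i := by
    intro i
    induction i with
    | zero =>
      intro _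
      have := Finset.card_le_card_of_injOn (s := Finset.Ioc k n) (t := Finset.range (f 0)) f
        (fun j hj => by
          have := Finset.mem_Ioc.1 hj
          simpa using after_lt 0 j (by omega) (by omega) (by omega))
        (fun i hi j hj h => by
          have := Finset.mem_Ioc.1 hi
          have := Finset.mem_Ioc.1 hj
          exact hf.inj i (by omega) j (by omega) h)
      simpa using this
    | succ i ih =>
      intro hi
      have := ih (by omega)
      have := mono i (i + 1) (by omega) hi
      omega
  have upper : ∀ d ≤ k, f (k - d) + d ≤ n := by
    intro d
    induction d with
    | zero => intro _; simp [hkn]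
    | succ d ih =>
      intro hd
      have := ih (by omega)
      have := mono (k - (d + 1)) (k - d) (by omega) (by omega)
      omega
  have head : ∀ i ≤ k, f i = i + (n - k) := fun i hi => by
    have := lower i hi
    have := upper (k - i) (by omega)
    rw [Nat.sub_sub_self hi] at this
    omega
  refine ⟨n - k - 1, by omega, fun j => if j < n - k then f (k + 1 + j) else j,
    ⟨fun i hi => ?_, fun i hi j hj h => ?_, fun i hi => ?_⟩, funext fun i => ?_⟩
  · have := after_lt 0 (k + 1 + i) (by omega) (by omega) (by omega)
    have := head 0 (by omega)
    simp only [show i < n - k by omega, if_true]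
    omega
  · simp only [show i < n - k by omega, show j < n - k by omega, if_true] at h
    have := hf.inj _ (by omega) _ (by omega) h
    omega
  · simp [show ¬ i < n - k by omega]
  · have h1 : n - (n - k - 1) = k + 1 := by omega
    have h2 : n - k - 1 + 1 = n - k := by omega
    rw [h1, h2]
    rcases lt_or_ge i (k + 1) with h | h
    · rw [skewIdSum_of_lt h, head i (by omega)]
    · obtain ⟨j, rfl⟩ := Nat.exists_eq_add_of_le h
      by_cases hj : j < n - k
      · rw [skewIdSum_add hj, if_pos hj]
      · rw [skewIdSum_of_le (by omega), hf.fix _ (by omega)]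

/-- The function on `ℕ` acting as `π` below `n` and as the identity elsewhere. -/
def extendPerm {n : ℕ} (π : Equiv.Perm (Fin n)) (i : ℕ) : ℕ :=
  if h : i < n then π ⟨i, h⟩ else i

lemma extendPerm_coe {n : ℕ} (π : Equiv.Perm (Fin n)) (i : Fin n) : extendPerm π i = π i := by
  simp [extendPerm]

lemma isPermBelow_extendPerm {n : ℕ} (π : Equiv.Perm (Fin n)) : IsPermBelow n (extendPerm π) where
  lt i hi := by simp [extendPerm, hi]
  inj i hi j hj h := by simpa [extendPerm, hi, hj, ← Fin.ext_iff] using h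
  fix i hi := by simp [extendPerm, hi.not_gt]

lemma extendPerm_injective {n : ℕ} : Function.Injective (extendPerm (n := n)) := by
  intro π σ h
  ext i
  rw [← extendPerm_coe, h, extendPerm_coe]

lemma IsPermBelow.exists_extendPerm {n : ℕ} {f : ℕ → ℕ} (hf : IsPermBelow n f) :
    ∃ π : Equiv.Perm (Fin n), extendPerm π = f := by
  have inj : Function.Injective (fun i : Fin n => (⟨f i, hf.lt i i.2⟩ : Fin n)) := fun i j h =>
    Fin.ext (hf.inj i i.2 j j.2 (Fin.ext_iff.1 h))
  refine ⟨Equiv.ofBijective _ (Finite.injective_iff_bijective.1 inj), funext fun i => ?_⟩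
  by_cases hi : i < n
  · simp [extendPerm, hi]
  · simp [extendPerm, hi, hf.fix i (by omega)]

/-- The permutations of size `n` avoiding `132` and `3241` and satisfying `P n`. -/
def avoiders (P : ℕ → (ℕ → ℕ) → Prop) (n : ℕ) : Set (ℕ → ℕ) :=
  {f | IsPermBelow n f ∧ Avoids132 n f ∧ Avoids3241 n f ∧ P n f}

lemma finite_avoiders (P : ℕ → (ℕ → ℕ) → Prop) (n : ℕ) : (avoiders P n).Finite :=
  (Set.finite_range (extendPerm (n := n))).subset fun _ hf => hf.1.exists_extendPerm

lemma ncard_avoiders_zero {P : ℕ → (ℕ → ℕ) → Prop} (hP : ∀ f, P 0 f) :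
    (avoiders P 0).ncard = 1 := by
  rw [Set.ncard_eq_one]
  refine ⟨id, Set.eq_singleton_iff_unique_mem.2 ⟨⟨⟨?_, ?_, ?_⟩, ?_, ?_, hP _⟩, fun f hf => ?_⟩⟩
  · intro i hi; omega
  · intro i hi; omega
  · intro i _; rfl
  · intro i j k _ _ hk; omega
  · intro i j k l _ _ _ hl; omega
  · exact funext fun i => hf.1.fix i (Nat.zero_le i)

lemma avoiders_succ {P Q R : ℕ → (ℕ → ℕ) → Prop} {p : ℕ → Prop} [DecidablePred p]
    (hQ : ∀ {n f}, IsPermBelow n f → (P (n + 1) f ↔ Q n f))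
    (hR : ∀ {m r f}, 0 < m → IsPermBelow r f → (P (m + r) (skewIdSum m r f) ↔ p m ∧ R r f))
    (n : ℕ) :
    avoiders P (n + 1) = avoiders Q n ∪ ⋃ r ∈ Finset.range n,
      skewIdSum (n - r) (r + 1) '' (if p (n - r) then avoiders R (r + 1) else ∅) := by
  have skew_iff : ∀ r < n, ∀ g, IsPermBelow (r + 1) g →
      (skewIdSum (n - r) (r + 1) g ∈ avoiders P (n + 1) ↔
        p (n - r) ∧ g ∈ avoiders R (r + 1)) := by
    intro r hr g hg
    have hnr : n + 1 = n - r + (r + 1) := by omega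
    have hF := isPermBelow_skewIdSum (m := n - r) hg
    simp only [avoiders, Set.mem_ofPred_eq]
    rw [hnr, hR (by omega) hg, avoids132_skewIdSum hg, avoids3241_skewIdSum hg]
    tauto
  ext f
  simp only [Set.mem_union, Set.mem_iUnion, Finset.mem_range, exists_prop]
  constructor
  · intro hf
    by_cases hn : f n = n
    · have hf' := hf.1.of_succ hn
      exact .inl ⟨hf', (avoids132_succ hf').1 hf.2.1, (avoids3241_succ hf').1 hf.2.2.1,
        (hQ hf').1 hf.2.2.2⟩
    · obtain ⟨r, hr, g, hg, rfl⟩ := hf.1.exists_eq_skewIdSum hf.2.1 hf.2.2.1 hn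
      obtain ⟨hp, hg'⟩ := (skew_iff r hr g hg).1 hf
      exact .inr ⟨r, hr, g, by rwa [if_pos hp], rfl⟩
  · rintro (hf | ⟨r, hr, g, hg, rfl⟩)
    · exact ⟨hf.1.succ, (avoids132_succ hf.1).2 hf.2.1, (avoids3241_succ hf.1).2 hf.2.2.1,
        (hQ hf.1).2 hf.2.2.2⟩
    · split_ifs at hg with hp
      · exact (skew_iff r hr g hg.1).2 ⟨hp, hg⟩
      · exact hg.elim

lemma ncard_avoiders_succ {P Q R : ℕ → (ℕ → ℕ) → Prop} {p : ℕ → Prop} [DecidablePred p]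
    (hQ : ∀ {n f}, IsPermBelow n f → (P (n + 1) f ↔ Q n f))
    (hR : ∀ {m r f}, 0 < m → IsPermBelow r f → (P (m + r) (skewIdSum m r f) ↔ p m ∧ R r f))
    (n : ℕ) :
    (avoiders P (n + 1)).ncard = (avoiders Q n).ncard +
      ∑ r ∈ Finset.range n, if p (n - r) then (avoiders R (r + 1)).ncard else 0 := by
  set S : ℕ → Set (ℕ → ℕ) := fun r => if p (n - r) then avoiders R (r + 1) else ∅ with hS
  have S_perm : ∀ r, S r ⊆ {f | IsPermBelow (r + 1) f} := by
    intro r f hf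
    simp only [hS] at hf
    split_ifs at hf
    exacts [hf.1, hf.elim]
  have S_fin : ∀ r, (S r).Finite := by
    intro r
    simp only [hS]
    split_ifs
    exacts [finite_avoiders _ _, Set.finite_empty]
  have max_pos : ∀ r < n, ∀ g, skewIdSum (n - r) (r + 1) g (n - r - 1) = n := by
    intro r hr g
    rw [skewIdSum_of_lt (by omega)]
    omega
  rw [avoiders_succ hQ hR]
  change (avoiders Q n ∪ ⋃ r ∈ (Finset.range n : Set ℕ),
    skewIdSum (n - r) (r + 1) '' S r).ncard = _
  rw [Set.ncard_union_eq ?_ (finite_avoiders _ _)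
    (Set.Finite.biUnion (Finset.finite_toSet _) fun r _ => (S_fin r).image _)]
  · congr 1
    rw [(Finset.finite_toSet _).ncard_biUnion (fun r _ => (S_fin r).image _) ?_]
    · rw [finsum_mem_coe_finset]
      refine Finset.sum_congr rfl fun r _ => ?_
      rw [(skewIdSum_injOn.mono (S_perm r)).ncard_image]
      simp only [hS]
      split_ifs <;> simp
    · intro r hr s hs hrs
      refine Set.disjoint_left.2 ?_
      rintro _ ⟨g, hg, rfl⟩ ⟨h, hh, e⟩
      have hr : r < n := by simpa using hr
      have hs : s < n := by simpa using hs
      have inj := (isPermBelow_skewIdSum (m := n - r) (S_perm r hg)).inj (n - r - 1) (by omega)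
        (n - s - 1) (by omega)
      rw [max_pos r hr, ← e, max_pos s hs] at inj
      have := inj rfl
      omega
  · refine Set.disjoint_left.2 fun f hf hf' => ?_
    simp only [Set.mem_iUnion, Finset.coe_range, Set.mem_Iio, exists_prop] at hf'
    obtain ⟨r, hr, g, hg, rfl⟩ := hf'
    have := hf.1.lt (n - r - 1) (by omega)
    rw [max_pos r hr] at this
    omega

lemma ncard_avoiders12 (n : ℕ) : (avoiders Avoids12 n).ncard = 1 := by
  induction n with
  | zero => exact ncard_avoiders_zero fun f i j _ hj => by omega
  | succ n ih =>
    rw [ncard_avoiders_succ (Q := fun n _ => n = 0) (R := Avoids12) (p := fun m => m = 1)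
      avoids12_succ avoids12_skewIdSum]
    cases n with
    | zero => simp [ncard_avoiders_zero]
    | succ n =>
      have empty : avoiders (fun n _ => n = 0) (n + 1) = ∅ :=
        Set.eq_empty_of_forall_notMem fun f hf => Nat.succ_ne_zero n hf.2.2.2
      rw [empty, Finset.sum_range_succ, Finset.sum_eq_zero]
      · simpa using ih
      · intro r hr
        rw [if_neg]
        have := Finset.mem_range.1 hr
        omega

lemma ncard_avoiders123_succ (n : ℕ) :
    (avoiders Avoids123 (n + 1)).ncard + 1 = Nat.fib (n + 3) := by
  have rec_succ := ncard_avoiders_succ (P := Avoids123) (p := fun m => m ≤ 2)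
    avoids123_succ fun _ => avoids123_skewIdSum
  induction n using Nat.strong_induction_on with
  | _ n ih =>
    rw [rec_succ, ncard_avoiders12]
    match n with
    | 0 => simp [Nat.fib]
    | 1 =>
      have := ih 0 (by omega)
      norm_num [Nat.fib_add_two] at this
      norm_num [Nat.fib_add_two]
      omega
    | n + 2 =>
      have h0 := ih n (by omega)
      have h1 := ih (n + 1) (by omega)
      rw [Finset.sum_range_succ, Finset.sum_range_succ, Finset.sum_eq_zero]
      · simp only [show n + 2 - n ≤ 2 by omega, show n + 2 - (n + 1) ≤ 2 by omega, if_true]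
        have := Nat.fib_add_two (n := n + 3)
        rw [show n + 2 + 3 = n + 3 + 2 by ring, this, ← h0, show n + 3 + 1 = n + 1 + 3 by ring,
          ← h1]
        ring
      · intro r hr
        rw [if_neg]
        have := Finset.mem_range.1 hr
        omega

lemma sum_ncard_avoiders123 (n : ℕ) :
    (∑ r ∈ Finset.range n, (avoiders Avoids123 (r + 1)).ncard) + n + 3 = Nat.fib (n + 4) := by
  induction n with
  | zero => simp [Nat.fib]
  | succ n ih =>
    have := ncard_avoiders123_succ n
    have := Nat.fib_add_two (n := n + 3)
    rw [Finset.sum_range_succ, show n + 1 + 4 = n + 3 + 2 by ring]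
    simp only [show n + 3 + 1 = n + 4 by ring] at this
    omega

lemma ncard_avoiders4123 (n : ℕ) :
    ((avoiders Avoids4123 n).ncard : ℤ) = Nat.fib (n + 5) - n.choose 2 - 3 * n - 4 := by
  induction n with
  | zero =>
    rw [ncard_avoiders_zero fun f i j k l _ _ _ hl => by omega]
    norm_num [Nat.fib_add_two]
  | succ n ih =>
    rw [ncard_avoiders_succ (Q := Avoids4123) (R := Avoids123) (p := fun _ => True)
      avoids4123_succ (fun hm hf => by simpa using avoids4123_skewIdSum hm hf)]
    have h := sum_ncard_avoiders123 n
    have hfib := Nat.fib_add_two (n := n + 4)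
    have hch := Nat.choose_succ_succ n 1
    simp only [if_true, Nat.choose_one_right, Nat.succ_eq_add_one, Nat.reduceAdd] at hch ⊢
    rw [show n + 1 + 5 = n + 4 + 2 by ring, hfib, hch]
    zify at h
    push_cast
    rw [ih]
    linarith

lemma sum_ncard_avoiders4123 (n : ℕ) :
    (∑ r ∈ Finset.range n, ((avoiders Avoids4123 (r + 1)).ncard : ℤ)) =
      Nat.fib (n + 7) - (n + 1).choose 3 - 3 * (n + 1).choose 2 - 4 * n - 13 := by
  induction n with
  | zero => norm_num [Nat.fib_add_two, Nat.choose]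
  | succ n ih =>
    rw [Finset.sum_range_succ, ih, ncard_avoiders4123]
    have hfib := Nat.fib_add_two (n := n + 6)
    have h3 := Nat.choose_succ_succ (n + 1) 2
    have h2 := Nat.choose_succ_succ (n + 1) 1
    simp only [Nat.choose_one_right, Nat.succ_eq_add_one, Nat.reduceAdd] at h2 h3
    rw [show n + 1 + 7 = n + 6 + 2 by ring, hfib, h3, h2]
    push_cast
    ring_nf

lemma ncard_avoiders54123 (n : ℕ) :
    ((avoiders Avoids54123 n).ncard : ℤ) =
      Nat.fib (n + 8) - Nat.choose (n + 1) 4 - 3 * Nat.choose (n + 1) 3 -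
        4 * Nat.choose (n + 1) 2 - 9 * Nat.choose (n + 1) 1 - 11 := by
  induction n with
  | zero =>
    rw [ncard_avoiders_zero fun f h i j k l _ _ _ _ hl => by omega]
    norm_num [Nat.fib_add_two, Nat.choose]
  | succ n ih =>
    rw [ncard_avoiders_succ (Q := Avoids54123) (R := Avoids4123) (p := fun _ => True)
      avoids54123_succ (fun hm hf => by simpa using avoids54123_skewIdSum hm hf)]
    have h := sum_ncard_avoiders4123 n
    have hfib := Nat.fib_add_two (n := n + 7)
    have h4 := Nat.choose_succ_succ (n + 1) 3
    have h3 := Nat.choose_succ_succ (n + 1) 2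
    have h2 := Nat.choose_succ_succ (n + 1) 1
    simp only [if_true, Nat.choose_one_right, Nat.succ_eq_add_one, Nat.reduceAdd] at h2 h3 h4 ih ⊢
    rw [show n + 1 + 8 = n + 7 + 2 by ring, hfib, h4, h3, h2]
    push_cast at ih ⊢
    rw [ih, h]
    ring_nf

section Patterns

variable {n : ℕ} (π : Equiv.Perm (Fin n))

lemma pAvoids_p132_iff : PAvoids π p132 ↔ Avoids132 n (extendPerm π) := by
  constructor
  · rintro h i j k hij hjk hk ⟨h1, h2⟩
    have ⟨hi, hj⟩ : i < n ∧ j < n := by omega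
    lift i to Fin n using hi
    lift j to Fin n using hj
    lift k to Fin n using hk
    simp only [extendPerm_coe, Fin.val_fin_lt] at hij hjk h1 h2
    refine h ⟨![i, j, k], ?_, ?_⟩
    · simp [Fin.strictMono_iff_lt_succ, Fin.forall_fin_succ, hij, hjk]
    · simp [p132, Fin.forall_fin_succ]
      omega
  · rintro h ⟨f, hf, hσ⟩
    refine h (f 0) (f 1) (f 2) (hf (by decide)) (hf (by decide)) (f 2).2 ?_
    simp only [extendPerm_coe, Fin.val_fin_lt, hσ]
    simp [p132]

lemma pAvoids_p3241_iff : PAvoids π p3241 ↔ Avoids3241 n (extendPerm π) := by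
  constructor
  · rintro h i j k l hij hjk hkl hl ⟨h1, h2, h3⟩
    have ⟨hi, hj, hk⟩ : i < n ∧ j < n ∧ k < n := by omega
    lift i to Fin n using hi
    lift j to Fin n using hj
    lift k to Fin n using hk
    lift l to Fin n using hl
    simp only [extendPerm_coe, Fin.val_fin_lt] at hij hjk hkl h1 h2 h3
    refine h ⟨![i, j, k, l], ?_, ?_⟩
    · simp [Fin.strictMono_iff_lt_succ, Fin.forall_fin_succ, hij, hjk, hkl]
    · simp [p3241, Fin.forall_fin_succ]
      omega
  · rintro h ⟨f, hf, hσ⟩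
    refine h (f 0) (f 1) (f 2) (f 3) (hf (by decide)) (hf (by decide)) (hf (by decide)) (f 3).2 ?_
    simp only [extendPerm_coe, Fin.val_fin_lt, hσ]
    simp [p3241]

lemma pAvoids_mu23_iff : PAvoids π mu23 ↔ Avoids54123 n (extendPerm π) := by
  constructor
  · rintro h e i j k l hei hij hjk hkl hl ⟨h1, h2, h3, h4⟩
    have ⟨he, hi, hj, hk⟩ : e < n ∧ i < n ∧ j < n ∧ k < n := by omega
    lift e to Fin n using he
    lift i to Fin n using hi
    lift j to Fin n using hj
    lift k to Fin n using hk
    lift l to Fin n using hl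
    simp only [extendPerm_coe, Fin.val_fin_lt] at hei hij hjk hkl h1 h2 h3 h4
    refine h ⟨![e, i, j, k, l], ?_, ?_⟩
    · simp [Fin.strictMono_iff_lt_succ, Fin.forall_fin_succ, hei, hij, hjk, hkl]
    · simp [mu23, Fin.forall_fin_succ]
      omega
  · rintro h ⟨f, hf, hσ⟩
    refine h (f 0) (f 1) (f 2) (f 3) (f 4) (hf (by decide)) (hf (by decide)) (hf (by decide))
      (hf (by decide)) (f 4).2 ?_
    simp only [extendPerm_coe, Fin.val_fin_lt, hσ]
    simp [mu23]

end Patterns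

lemma card_pAvoids_eq_ncard (n : ℕ) :
    Nat.card {π : Equiv.Perm (Fin n) // PAvoids π p132 ∧ PAvoids π p3241 ∧ PAvoids π mu23} =
      (avoiders Avoids54123 n).ncard := by
  have image : avoiders Avoids54123 n =
      extendPerm '' {π : Equiv.Perm (Fin n) |
        PAvoids π p132 ∧ PAvoids π p3241 ∧ PAvoids π mu23} := by
    ext f
    constructor
    · rintro ⟨hf, h⟩
      obtain ⟨π, rfl⟩ := hf.exists_extendPerm
      exact ⟨π, by simpa [pAvoids_p132_iff, pAvoids_p3241_iff, pAvoids_mu23_iff] using h, rfl⟩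
    · rintro ⟨π, h, rfl⟩
      exact ⟨isPermBelow_extendPerm π,
        by simpa [pAvoids_p132_iff, pAvoids_p3241_iff, pAvoids_mu23_iff] using h⟩
  rw [image, Set.ncard_image_of_injective _ extendPerm_injective]
  rfl

/-- For `n ≥ 1`,
`|S_n(132, 3241, μ_{2,3}) = F_{n+8} - C(n+1,4) - 3C(n+1,3) - 4C(n+1,2) - 9C(n+1,1) - 11`. -/
theorem statement13 (n : ℕ) (hn : 1 ≤ n) :
    (Nat.card {π : Equiv.Perm (Fin n) //
        PAvoids π p132 ∧ PAvoids π p3241 ∧ PAvoids π mu23} : ℤ) =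
      Nat.fib (n + 8) - Nat.choose (n + 1) 4 - 3 * Nat.choose (n + 1) 3 -
        4 * Nat.choose (n + 1) 2 - 9 * Nat.choose (n + 1) 1 - 11 := by
  rw [card_pAvoids_eq_ncard, ncard_avoiders54123]
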